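/- arXiv:1803.09878 — 2 statements merged into one kernel-verified Lean document; each statement's English description precedes it below -/
import Mathlib

section
/- Let n ≥ 3 be an integer. On the open cone of 2-convex λ ∈ ℝⁿ (λᵢ + λⱼ > 0 for all i ≠ j), the Brendle–Huisken speed G is differentiable and for every index i its partial derivative satisfies 0 < ∂G/∂λᵢ(λ) ≤ 1. -/
open Finset

/-- The Brendle–Huisken speed (κ = 0): `G(λ) = (∑_{i<j} 1/(λᵢ+λⱼ))⁻¹`. -/
noncomputable def BHspeed (n : ℕ) (lam : Fin n → ℝ) : ℝ :=
  (∑ i, ∑ j ∈ Finset.univ.filter (fun j => i < j), (lam i + lam j)⁻¹)⁻¹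

/-- The speed written with a single sum over the pairs `i < j`. -/
theorem BHspeed_eq_inv_sum_pairs (n : ℕ) :
    BHspeed n = fun lam : Fin n → ℝ =>
      (∑ p : Fin n × Fin n with p.1 < p.2, (lam p.1 + lam p.2)⁻¹)⁻¹ := by
  funext lam
  simp only [BHspeed, Finset.sum_filter, Fintype.sum_prod_type]

theorem sum_pairs_inv_pos {n : ℕ} (hn : 2 ≤ n) {lam : Fin n → ℝ}
    (h : ∀ i j, i ≠ j → 0 < lam i + lam j) :
    0 < ∑ p : Fin n × Fin n with p.1 < p.2, (lam p.1 + lam p.2)⁻¹ := by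
  refine Finset.sum_pos (fun p hp => inv_pos.2 (h _ _ (Finset.mem_filter.1 hp).2.ne)) ?_
  exact ⟨(⟨0, by omega⟩, ⟨1, by omega⟩), by simp⟩

/-- The Fréchet derivative of the speed on the 2-convex cone. -/
theorem hasFDerivAt_BHspeed {n : ℕ} (hn : 2 ≤ n) {lam : Fin n → ℝ}
    (h : ∀ i j, i ≠ j → 0 < lam i + lam j) :
    HasFDerivAt (BHspeed n)
      (-((∑ p : Fin n × Fin n with p.1 < p.2, (lam p.1 + lam p.2)⁻¹) ^ 2)⁻¹ •
        ∑ p : Fin n × Fin n with p.1 < p.2, -((lam p.1 + lam p.2) ^ 2)⁻¹ •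
          (ContinuousLinearMap.proj (R := ℝ) (φ := fun _ : Fin n => ℝ) p.1 +
            ContinuousLinearMap.proj p.2)) lam := by
  rw [BHspeed_eq_inv_sum_pairs]
  refine (hasDerivAt_inv (sum_pairs_inv_pos hn h).ne').comp_hasFDerivAt lam
    (HasFDerivAt.fun_sum fun p hp => ?_)
  exact (hasDerivAt_inv (h _ _ (Finset.mem_filter.1 hp).2.ne).ne').comp_hasFDerivAt lam
    ((hasFDerivAt_apply p.1 lam).add (hasFDerivAt_apply p.2 lam))

/-- Proposition 2.1(ii): on the open cone of 2-convex `λ` the speed `G` is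
differentiable and each partial derivative `∂G/∂λᵢ` lies in `(0, 1]`. -/
theorem BHspeed_partialDeriv_mem_Ioc (n : ℕ) (hn : 3 ≤ n) (lam : Fin n → ℝ)
    (h2 : ∀ i j, i ≠ j → 0 < lam i + lam j) :
    DifferentiableAt ℝ (BHspeed n) lam ∧
      ∀ i : Fin n,
        0 < fderiv ℝ (BHspeed n) lam (Pi.single i 1) ∧
          fderiv ℝ (BHspeed n) lam (Pi.single i 1) ≤ 1 := by
  have hn2 : 2 ≤ n := by omega
  have hG := hasFDerivAt_BHspeed hn2 h2
  refine ⟨hG.differentiableAt, fun k => ?_⟩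
  have hS := sum_pairs_inv_pos hn2 h2
  have hpos : ∀ p ∈ ({p | p.1 < p.2} : Finset (Fin n × Fin n)),
      0 < (lam p.1 + lam p.2)⁻¹ := fun p hp =>
    inv_pos.2 (h2 _ _ (Finset.mem_filter.1 hp).2.ne)
  set S := ∑ p : Fin n × Fin n with p.1 < p.2, (lam p.1 + lam p.2)⁻¹ with hSdef
  let e : Fin n → ℝ := Pi.single k 1
  have he : ∀ i, e i = if i = k then 1 else 0 := fun i => Pi.single_apply k 1 i
  have he0 : ∀ i, 0 ≤ e i := fun i => by rw [he]; split_ifs <;> norm_num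
  have hderiv : fderiv ℝ (BHspeed n) lam (Pi.single k 1) =
      (∑ p : Fin n × Fin n with p.1 < p.2,
        ((lam p.1 + lam p.2)⁻¹) ^ 2 * (e p.1 + e p.2)) / S ^ 2 := by
    rw [hG.fderiv]
    simp [e, div_eq_inv_mul, mul_add, ← neg_add, -neg_add_rev]
  rw [hderiv]
  constructor
  · refine div_pos (Finset.sum_pos' (fun p hp => ?_) ?_) (pow_pos hS 2)
    · exact mul_nonneg (sq_nonneg _) (add_nonneg (he0 _) (he0 _))
    · have : Nontrivial (Fin n) := Fin.nontrivial_iff_two_le.2 hn2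
      have hek : e k = 1 := by simp [he]
      obtain ⟨j, hj⟩ := exists_ne k
      rcases lt_or_gt_of_ne hj with hlt | hlt
      · have hm : (j, k) ∈ ({p | p.1 < p.2} : Finset (Fin n × Fin n)) := by simpa using hlt
        exact ⟨(j, k), hm, mul_pos (pow_pos (hpos _ hm) 2) (by linarith [he0 j])⟩
      · have hm : (k, j) ∈ ({p | p.1 < p.2} : Finset (Fin n × Fin n)) := by simpa using hlt
        exact ⟨(k, j), hm, mul_pos (pow_pos (hpos _ hm) 2) (by linarith [he0 j])⟩
  · rw [div_le_one (pow_pos hS 2), sq S]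
    nth_rewrite 1 [hSdef]
    rw [Finset.sum_mul]
    refine Finset.sum_le_sum fun p hp => ?_
    have hle : e p.1 + e p.2 ≤ 1 := by
      have hne : p.1 ≠ p.2 := (Finset.mem_filter.1 hp).2.ne
      rw [he, he]
      split_ifs with h1 h3
      · exact absurd (h1.trans h3.symm) hne
      all_goals norm_num
    calc ((lam p.1 + lam p.2)⁻¹) ^ 2 * (e p.1 + e p.2)
        ≤ ((lam p.1 + lam p.2)⁻¹) ^ 2 := mul_le_of_le_one_right (sq_nonneg _) hle
      _ = (lam p.1 + lam p.2)⁻¹ * (lam p.1 + lam p.2)⁻¹ := sq _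
      _ ≤ (lam p.1 + lam p.2)⁻¹ * S := mul_le_mul_of_nonneg_left
          (Finset.single_le_sum (f := fun p : Fin n × Fin n => (lam p.1 + lam p.2)⁻¹)
            (fun q hq => (hpos q hq).le) hp) (hpos p hp).le
end

section
/- Let c♯ > 0, G♯ > 0, γ > 1 and S ≥ 0. Let f : [0, S] → (0, ∞) be differentiable and suppose that |f′(s)| ≤ c♯·f(s)² holds at every s ∈ [0, S] at which f(s) ≥ G♯. If f(0) ≥ γ·G♯ and S ≤ (γ−1)/(c♯·f(0)), then for every s ∈ [0, S] one has f(s) ≥ f(0)/(1 + c♯·s·f(0)) ≥ f(0)/γ ≥ G♯. -/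
open Set

/-- The one-dimensional (along-a-geodesic) form of Lemma 3.1: if
`|f′| ≤ c♯ f²` wherever `f ≥ G♯`, `f(0) ≥ γ G♯` and the length is at most
`(γ−1)/(c♯ f(0))`, then `f(s) ≥ f(0)/(1 + c♯ s f(0)) ≥ f(0)/γ ≥ G♯`. -/
theorem gradient_estimate_along_geodesic
    (csharp Gsharp γ S : ℝ) (hcs : 0 < csharp) (hGs : 0 < Gsharp)
    (hγ : 1 < γ) (hS : 0 ≤ S)
    (f f' : ℝ → ℝ)
    (hderiv : ∀ s ∈ Icc (0 : ℝ) S, HasDerivAt f (f' s) s)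
    (hpos : ∀ s ∈ Icc (0 : ℝ) S, 0 < f s)
    (hgrad : ∀ s ∈ Icc (0 : ℝ) S, Gsharp ≤ f s → |f' s| ≤ csharp * (f s) ^ 2)
    (h0 : γ * Gsharp ≤ f 0)
    (hSle : S ≤ (γ - 1) / (csharp * f 0)) :
    ∀ s ∈ Icc (0 : ℝ) S,
      f 0 / (1 + csharp * s * f 0) ≤ f s ∧
        f 0 / γ ≤ f 0 / (1 + csharp * s * f 0) ∧
          Gsharp ≤ f 0 / γ := by
  have hf0 : 0 < f 0 := hpos 0 ⟨le_rfl, hS⟩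
  have hγ0 : 0 < γ := by linarith
  have hlen : ∀ s ∈ Icc (0 : ℝ) S, 1 + csharp * s * f 0 ≤ γ := by
    intro s hs
    have h := (le_div_iff₀ (mul_pos hcs hf0)).1 (hs.2.trans hSle)
    nlinarith
  have hfloor : Gsharp ≤ f 0 / γ := by
    rw [le_div_iff₀ hγ0]
    linarith
  intro s hs
  have hden : 0 < 1 + csharp * s * f 0 := by
    have := mul_nonneg (mul_nonneg hcs.le hs.1) hf0.le
    linarith
  have hbarrier : f 0 / γ ≤ f 0 / (1 + csharp * s * f 0) :=
    div_le_div_of_nonneg_left hf0.le hden (hlen s hs)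
  refine ⟨?_, hbarrier, hfloor⟩
  have hinv : (f 0 / (1 + csharp * s * f 0))⁻¹ = (f 0)⁻¹ + csharp * s := by
    field_simp
  have hshrink : ∀ θ ∈ Ioo (0 : ℝ) 1, (f (θ * s))⁻¹ ≤ (f 0)⁻¹ + csharp * s := by
    intro θ hθ
    have hθs : θ * s ≤ s := mul_le_of_le_one_left hs.1 hθ.2.le
    have hsub : ∀ x ∈ Icc 0 (θ * s), x ∈ Icc 0 S :=
      fun x hx => ⟨hx.1, hx.2.trans (hθs.trans hs.2)⟩
    have hder : ∀ x ∈ Icc 0 (θ * s), HasDerivAt (fun y => (f y)⁻¹) (-f' x / f x ^ 2) x :=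
      fun x hx => (hderiv x (hsub x hx)).fun_inv (hpos x (hsub x hx)).ne'
    have key := image_le_of_deriv_right_lt_deriv_boundary
      (f := fun y => (f y)⁻¹) (B := fun x => (f 0)⁻¹ + csharp / θ * x) (B' := fun _ => csharp / θ)
      (fun x hx => (hder x hx).continuousAt.continuousWithinAt)
      (fun x hx => (hder x (Ico_subset_Icc_self hx)).hasDerivWithinAt)
      (by simp)
      (fun x => by simpa using ((hasDerivAt_id x).const_mul (csharp / θ)).const_add (f 0)⁻¹)
      (by
        intro x hx hxB
        have hxS := hsub x (Ico_subset_Icc_self hx)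
        have hfx := hpos x hxS
        have hle : csharp / θ * x ≤ csharp * s := by
          rw [div_mul_eq_mul_div, div_le_iff₀ hθ.1]
          nlinarith [hx.2]
        have hG : Gsharp ≤ f x := by
          refine (hfloor.trans hbarrier).trans ((inv_le_inv₀ hfx (div_pos hf0 hden)).1 ?_)
          rw [hinv]
          linarith
        have hgx := (neg_le_abs (f' x)).trans (hgrad x hxS hG)
        have hlt : csharp < csharp / θ := by
          rw [lt_div_iff₀ hθ.1]
          exact mul_lt_of_lt_one_right hcs hθ.2
        exact ((div_le_iff₀ (pow_pos hfx 2)).2 hgx).trans_lt hlt)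
      (right_mem_Icc.2 (mul_nonneg hθ.1.le hs.1))
    have hend : csharp / θ * (θ * s) = csharp * s := by
      have := hθ.1.ne'
      field_simp
    simpa only [hend] using key
  have hcont : ContinuousAt (fun θ : ℝ => (f (θ * s))⁻¹) 1 := by
    have hfs : ContinuousAt f (1 * s) := by simpa using (hderiv s hs).continuousAt
    refine ContinuousAt.inv₀ (ContinuousAt.comp (f := fun θ : ℝ => θ * s) hfs (by fun_prop)) ?_
    simpa using (hpos s hs).ne'
  have hlim : (f (1 * s))⁻¹ ≤ (f 0)⁻¹ + csharp * s := by
    refine le_of_tendsto (hcont.tendsto.mono_left (nhdsWithin_le_nhds (s := Iio 1))) ?_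
    filter_upwards [Ioo_mem_nhdsLT (zero_lt_one' ℝ)] with θ hθ using hshrink θ hθ
  rw [one_mul, ← hinv] at hlim
  exact (inv_le_inv₀ (hpos s hs) (div_pos hf0 hden)).1 hlim
end
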